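/- If t is a rational number such that −t⁴ + t² + 1 is a square of a rational number, then t = 0, t = 1 or t = −1. -/

import Mathlib

/-- Coprime positive integers whose product is a fourth power are themselves fourth powers. -/
theorem exists_fourth_powers_of_mul_eq {P Q v : ℤ} (hP : 0 < P) (hQ : 0 < Q)
    (hPQ : IsCoprime P Q) (h : P * Q = v ^ 4) :
    ∃ r s : ℤ, P = r ^ 4 ∧ Q = s ^ 4 ∧ v ^ 2 = r ^ 2 * s ^ 2 ∧ IsCoprime r s := by
  have key : ∀ {A B : ℤ}, 0 < A → IsCoprime A B → A * B = v ^ 4 → ∃ d : ℤ, A = d ^ 4 := by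
    intro A B hA hAB hv
    obtain ⟨d, hd⟩ := exists_associated_pow_of_mul_eq_pow' hAB hv
    rcases Int.associated_iff.mp hd with h1 | h1
    · exact ⟨d, h1.symm⟩
    · have : 0 ≤ d ^ 4 := by positivity
      omega
  obtain ⟨r, rfl⟩ := key hP hPQ h
  obtain ⟨s, rfl⟩ := key hQ hPQ.symm (by rw [mul_comm, h])
  refine ⟨r, s, rfl, rfl, ?_, (IsCoprime.pow_iff (by norm_num) (by norm_num)).mp hPQ⟩
  refine (pow_left_inj₀ (by positivity) (by positivity) two_ne_zero).mp ?_
  linear_combination -h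

/-- Coprime positive integers with product `5 * c ^ 4` are of the form `u ^ 4` and `5 * v ^ 4`. -/
theorem exists_add_eq_of_mul_eq_five_mul {P Q c : ℤ} (hP : 0 < P) (hQ : 0 < Q)
    (hPQ : IsCoprime P Q) (h : P * Q = 5 * c ^ 4) :
    ∃ u v : ℤ, P + Q = u ^ 4 + 5 * v ^ 4 ∧ c ^ 2 = u ^ 2 * v ^ 2 ∧ IsCoprime u v := by
  have h5 : Prime (5 : ℤ) := by norm_num
  have key : ∀ {A B : ℤ}, 0 < A → 0 < B → IsCoprime A B → A * B = 5 * c ^ 4 → 5 ∣ B →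
      ∃ u v : ℤ, A + B = u ^ 4 + 5 * v ^ 4 ∧ c ^ 2 = u ^ 2 * v ^ 2 ∧ IsCoprime u v := by
    rintro A _ hA hB hAB hc ⟨B, rfl⟩
    obtain ⟨u, v, rfl, rfl, huv, hcop⟩ := exists_fourth_powers_of_mul_eq (v := c) hA
      (by omega) hAB.of_mul_right_right (by linarith)
    exact ⟨u, v, rfl, huv, hcop⟩
  rcases h5.dvd_or_dvd (Dvd.intro _ h.symm) with hd | hd
  · rw [add_comm]
    exact key hQ hP hPQ.symm (by rw [mul_comm, h]) hd
  · exact key hP hQ hPQ h hd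

theorem prime_dvd_of_mul_self_dvd_five_mul {p a : ℤ} (hp : Prime p)
    (h : p * p ∣ 5 * a ^ 4) : p ∣ a := by
  by_contra hpa
  have hcop : IsCoprime p a := hp.irreducible.coprime_iff_not_dvd.mpr hpa
  have h5 : Prime (5 : ℤ) := by norm_num
  exact hp.not_isUnit (h5.irreducible.squarefree p
    ((hcop.mul_left hcop).pow_right.dvd_of_dvd_mul_right h))

theorem pos_and_pos_of_add_of_mul {P Q : ℤ} (hadd : 0 < P + Q) (hmul : 0 < P * Q) :
    0 < P ∧ 0 < Q := by
  rcases mul_pos_iff.mp hmul with h | h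
  · exact h
  · omega

/-- The descent step for odd `a`. -/
theorem descent_of_odd {a b y : ℤ} (hb : 0 < b) (ha : Odd a) (hab : IsCoprime a b)
    (h : y ^ 2 = b ^ 4 + a ^ 2 * b ^ 2 - a ^ 4) :
    ∃ r s u : ℤ, IsCoprime r s ∧ u ^ 2 = s ^ 4 + r ^ 2 * s ^ 2 - r ^ 4 ∧
      a ^ 2 = u ^ 2 * (r ^ 2 * s ^ 2) ∧ 2 * b = r ^ 4 + s ^ 4 := by
  have ha0 : a ≠ 0 := by rintro rfl; simp at ha
  have hmul : (2 * b ^ 2 + a ^ 2 - 2 * y) * (2 * b ^ 2 + a ^ 2 + 2 * y) = 5 * a ^ 4 := by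
    linear_combination -4 * h
  obtain ⟨hP, hQ⟩ := pos_and_pos_of_add_of_mul
    (P := 2 * b ^ 2 + a ^ 2 - 2 * y) (Q := 2 * b ^ 2 + a ^ 2 + 2 * y)
    (by ring_nf; positivity) (by rw [hmul]; positivity)
  have hcop : IsCoprime (2 * b ^ 2 + a ^ 2 - 2 * y) (2 * b ^ 2 + a ^ 2 + 2 * y) := by
    refine isCoprime_of_prime_dvd (fun h0 ↦ hP.ne' h0.1) fun p hp h1 h2 ↦ ?_
    have hpa : p ∣ a := prime_dvd_of_mul_self_dvd_five_mul hp (hmul ▸ mul_dvd_mul h1 h2)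
    have hp2 : ¬ p ∣ 2 := by
      intro hdvd
      obtain ⟨k, rfl⟩ := ha
      exact hp.not_dvd_one ((dvd_add_right (hdvd.mul_right k)).mp hpa)
    have h4 : p ∣ 2 * (2 * b ^ 2) := by
      have e : 2 * (2 * b ^ 2) = (2 * b ^ 2 + a ^ 2 - 2 * y) + (2 * b ^ 2 + a ^ 2 + 2 * y)
        - a * (2 * a) := by ring
      rw [e]
      exact dvd_sub (dvd_add h1 h2) (hpa.mul_right _)
    have hpb : p ∣ b := hp.dvd_of_dvd_pow
      ((hp.dvd_or_dvd ((hp.dvd_or_dvd h4).resolve_left hp2)).resolve_left hp2)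
    exact hp.not_isUnit (hab.isUnit_of_dvd' hpa hpb)
  obtain ⟨u, v, hadd, huv, hcuv⟩ := exists_add_eq_of_mul_eq_five_mul hP hQ hcop hmul
  have hodd : Odd u ∧ Odd v := by
    have := ha.pow (n := 2)
    rw [huv, Int.odd_mul] at this
    exact ⟨Int.Odd.of_mul_left (n := u) (by rw [← sq]; exact this.1),
      Int.Odd.of_mul_left (n := v) (by rw [← sq]; exact this.2)⟩
  obtain ⟨w, hw⟩ : ∃ w, u ^ 2 - v ^ 2 = 2 * w :=
    ((hodd.1.pow (n := 2)).sub_odd (hodd.2.pow (n := 2))).two_dvd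
  have hv0 : v ≠ 0 := by rintro rfl; simp at hodd
  have hbw : (b - w) * (b + w) = v ^ 4 := by
    have : 4 * ((b - w) * (b + w)) = 4 * v ^ 4 := by
      linear_combination hadd - 2 * huv + (u ^ 2 - v ^ 2 + 2 * w) * hw
    linarith
  obtain ⟨hR, hS⟩ := pos_and_pos_of_add_of_mul (P := b - w) (Q := b + w)
    (by linarith) (by rw [hbw]; positivity)
  have hcop' : IsCoprime (b - w) (b + w) := by
    refine isCoprime_of_prime_dvd (fun h0 ↦ hR.ne' h0.1) fun p hp h1 h2 ↦ ?_
    have hpv : p ∣ v := hp.dvd_of_dvd_pow (hbw ▸ h1.mul_right _)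
    have hpu : p ∣ u := by
      refine hp.dvd_of_dvd_pow (n := 2) ?_
      have e : u ^ 2 = (b + w) - (b - w) + v * v := by linear_combination hw
      rw [e]
      exact dvd_add (dvd_sub h2 h1) (hpv.mul_right _)
    exact hp.not_isUnit (hcuv.isUnit_of_dvd' hpu hpv)
  obtain ⟨r, s, hr, hs, hrs, hcrs⟩ := exists_fourth_powers_of_mul_eq hR hS hcop' hbw
  refine ⟨r, s, u, hcrs, ?_, by rw [huv, hrs], by linarith⟩
  linear_combination hw + hrs + hs - hr

/-- The descent step for even `a`. -/
theorem descent_of_even {a b y : ℤ} (hb : 0 < b) (ha0 : a ≠ 0) (ha : Even a)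
    (hab : IsCoprime a b) (h : y ^ 2 = b ^ 4 + a ^ 2 * b ^ 2 - a ^ 4) :
    ∃ r s u : ℤ, IsCoprime r s ∧ u ^ 2 = s ^ 4 + r ^ 2 * s ^ 2 - r ^ 4 ∧
      a ^ 2 = 4 * (u ^ 2 * (r ^ 2 * s ^ 2)) ∧ Odd (s ^ 4 - r ^ 4) := by
  obtain ⟨c, rfl⟩ := ha.two_dvd
  have hc0 : c ≠ 0 := by rintro rfl; simp at ha0
  have hbo : Odd b := by
    rw [← Int.not_even_iff_odd]
    intro hbe
    have := hab.isUnit_of_dvd' (Dvd.intro c rfl) hbe.two_dvd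
    exact Int.prime_two.not_isUnit this
  have hyo : Odd y := by
    have h1 : Odd (y ^ 2) := by
      rw [h, show b ^ 4 + (2 * c) ^ 2 * b ^ 2 - (2 * c) ^ 4
        = b ^ 4 + 2 * (2 * c ^ 2 * b ^ 2 - 8 * c ^ 4) by ring]
      exact hbo.pow.add_even (even_two_mul _)
    exact Int.Odd.of_mul_left (n := y) (by rwa [← sq])
  obtain ⟨P, hPe⟩ : ∃ P, b ^ 2 + 2 * c ^ 2 - y = 2 * P :=
    ((hbo.pow.add_even (even_two_mul _)).sub_odd hyo).two_dvd
  obtain ⟨Q, hQe⟩ : ∃ Q, b ^ 2 + 2 * c ^ 2 + y = 2 * Q :=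
    ((hbo.pow.add_even (even_two_mul _)).add_odd hyo).two_dvd
  have hsum : P + Q = b ^ 2 + 2 * c ^ 2 := by linarith
  have hmul : P * Q = 5 * c ^ 4 := by
    have : 4 * (P * Q) = 4 * (5 * c ^ 4) := by
      linear_combination -h - (2 * Q) * hPe - (b ^ 2 + 2 * c ^ 2 - y) * hQe
    linarith
  obtain ⟨hP, hQ⟩ := pos_and_pos_of_add_of_mul (P := P) (Q := Q)
    (by rw [hsum]; positivity) (by rw [hmul]; positivity)
  have hcop : IsCoprime P Q := by
    refine isCoprime_of_prime_dvd (fun h0 ↦ hP.ne' h0.1) fun p hp h1 h2 ↦ ?_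
    have hpc : p ∣ c := prime_dvd_of_mul_self_dvd_five_mul hp (hmul ▸ mul_dvd_mul h1 h2)
    have hpb : p ∣ b := by
      refine hp.dvd_of_dvd_pow (n := 2) ?_
      have e : b ^ 2 = P + Q - c * (2 * c) := by linear_combination -hsum
      rw [e]
      exact dvd_sub (dvd_add h1 h2) (hpc.mul_right _)
    exact hp.not_isUnit (hab.isUnit_of_dvd' (hpc.mul_left 2) hpb)
  obtain ⟨u, v, hadd, huv, hcuv⟩ := exists_add_eq_of_mul_eq_five_mul hP hQ hcop hmul
  have hv0 : v ≠ 0 := by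
    rintro rfl
    simp [hc0] at huv
  have hbw0 : b ^ 2 = (u ^ 2 - v ^ 2) ^ 2 + 4 * v ^ 4 := by
    linear_combination hadd - hsum - 2 * huv
  have hwo : Odd (u ^ 2 - v ^ 2) := by
    have h1 : Odd ((u ^ 2 - v ^ 2) ^ 2) := by
      rw [show (u ^ 2 - v ^ 2) ^ 2 = b ^ 2 - 2 * (2 * v ^ 4) by linear_combination -hbw0]
      exact hbo.pow.sub_even (even_two_mul _)
    exact Int.Odd.of_mul_left (n := u ^ 2 - v ^ 2) (by rwa [← sq])
  obtain ⟨R, hRe⟩ : ∃ R, b - (u ^ 2 - v ^ 2) = 2 * R := (hbo.sub_odd hwo).two_dvd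
  obtain ⟨S, hSe⟩ : ∃ S, b + (u ^ 2 - v ^ 2) = 2 * S := (hbo.add_odd hwo).two_dvd
  have hRS : R * S = v ^ 4 := by
    have : 4 * (R * S) = 4 * v ^ 4 := by
      linear_combination hbw0 - (2 * S) * hRe - (b - (u ^ 2 - v ^ 2)) * hSe
    linarith
  obtain ⟨hR, hS⟩ := pos_and_pos_of_add_of_mul (P := R) (Q := S)
    (by linarith) (by rw [hRS]; positivity)
  have hcop' : IsCoprime R S := by
    refine isCoprime_of_prime_dvd (fun h0 ↦ hR.ne' h0.1) fun p hp h1 h2 ↦ ?_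
    have hpv : p ∣ v := hp.dvd_of_dvd_pow (hRS ▸ h1.mul_right _)
    have hpu : p ∣ u := by
      refine hp.dvd_of_dvd_pow (n := 2) ?_
      have e : u ^ 2 = S - R + v * v := by linarith
      rw [e]
      exact dvd_add (dvd_sub h2 h1) (hpv.mul_right _)
    exact hp.not_isUnit (hcuv.isUnit_of_dvd' hpu hpv)
  obtain ⟨r, s, rfl, rfl, hrs, hcrs⟩ := exists_fourth_powers_of_mul_eq hR hS hcop' hRS
  refine ⟨r, s, u, hcrs, by linarith, by rw [← hrs]; linear_combination 4 * huv, ?_⟩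
  rwa [show s ^ 4 - r ^ 4 = u ^ 2 - v ^ 2 by linarith]

/-- The primitive integral solutions of `y ^ 2 = b ^ 4 + a ^ 2 * b ^ 2 - a ^ 4`. -/
theorem eq_zero_or_sq_eq_one_of_sq_eq {a b y : ℤ} (hab : IsCoprime a b)
    (h : y ^ 2 = b ^ 4 + a ^ 2 * b ^ 2 - a ^ 4) : a = 0 ∨ a ^ 2 = 1 ∧ b ^ 2 = 1 := by
  induction hn : a.natAbs using Nat.strong_induction_on generalizing a b y with
  | _ n ih =>
  subst hn
  by_cases ha0 : a = 0
  · exact Or.inl ha0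
  right
  have hb0 : b ≠ 0 := by
    rintro rfl
    have : 0 < a ^ 4 := by positivity
    nlinarith [sq_nonneg y]
  wlog hb : 0 < b generalizing b
  · have := this (b := -b) hab.neg_right (by rw [h]; ring) (by simpa using hb0) (by omega)
    simpa using this
  rcases Int.even_or_odd a with ha | ha
  · obtain ⟨r, s, u, hrs, hu, hau, hodd⟩ := descent_of_even hb ha0 ha hab h
    have hu0 : u ≠ 0 := by rintro rfl; simp [ha0] at hau
    have hr0 : r ≠ 0 := by rintro rfl; simp [ha0] at hau
    have hs0 : s ≠ 0 := by rintro rfl; simp [ha0] at hau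
    have hlt : r ^ 2 < a ^ 2 := by
      have h1 : 0 < u ^ 2 * s ^ 2 := by positivity
      have h2 : 0 < r ^ 2 := by positivity
      nlinarith
    rcases ih r.natAbs (Int.natAbs_lt_iff_sq_lt.mpr hlt) hrs hu rfl with h0 | ⟨hr, hs⟩
    · exact absurd h0 hr0
    · rw [show s ^ 4 - r ^ 4 = (s ^ 2) ^ 2 - (r ^ 2) ^ 2 by ring, hr, hs] at hodd
      simp at hodd
  · obtain ⟨r, s, u, hrs, hu, hau, hbe⟩ := descent_of_odd hb ha hab h
    have hu0 : u ≠ 0 := by rintro rfl; simp [ha0] at hau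
    have hr0 : r ≠ 0 := by rintro rfl; simp [ha0] at hau
    have hs0 : s ≠ 0 := by rintro rfl; simp [ha0] at hau
    have hu2 : 0 < u ^ 2 := by positivity
    have hr2 : 0 < r ^ 2 := by positivity
    have hs2 : 0 < s ^ 2 := by positivity
    have hrs1 : r ^ 2 = 1 ∧ s ^ 2 = 1 := by
      by_cases hus : u ^ 2 * s ^ 2 = 1
      · have hs1 : s ^ 2 = 1 := Int.eq_one_of_mul_eq_one_left hs2.le hus
        have hu1 : u ^ 2 = 1 := by rwa [hs1, mul_one] at hus
        refine ⟨?_, hs1⟩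
        have h1 : r ^ 2 * (r ^ 2 - 1) = 0 := by
          linear_combination hu - hu1 + (s ^ 2 + 1 + r ^ 2) * hs1
        have := (mul_eq_zero.mp h1).resolve_left hr2.ne'
        linarith
      · have h1 : 0 < u ^ 2 * s ^ 2 := by positivity
        have hlt : r ^ 2 < a ^ 2 := by
          have h3 : 2 ≤ u ^ 2 * s ^ 2 := by omega
          nlinarith
        exact (ih r.natAbs (Int.natAbs_lt_iff_sq_lt.mpr hlt) hrs hu rfl).resolve_left hr0
    obtain ⟨hr, hs⟩ := hrs1
    have hr4 : r ^ 4 = 1 := by rw [show r ^ 4 = (r ^ 2) ^ 2 by ring, hr, one_pow]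
    have hs4 : s ^ 4 = 1 := by rw [show s ^ 4 = (s ^ 2) ^ 2 by ring, hs, one_pow]
    rw [hr4, hs4, hr, hs] at hu
    rw [hu, hr, hs] at hau
    have hb1 : b = 1 := by omega
    exact ⟨by simpa using hau, by simp [hb1]⟩

theorem stmt_3 (t : ℚ) (h : ∃ y : ℚ, y ^ 2 = -t ^ 4 + t ^ 2 + 1) : t = 0 ∨ t = 1 ∨ t = -1 := by
  obtain ⟨y, hy⟩ := h
  have hd : (t.den : ℚ) ≠ 0 := by exact_mod_cast t.den_ne_zero
  have ht : t * t.den = t.num := Rat.mul_den_eq_num t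
  have hsq : (y * t.den ^ 2) ^ 2
      = (((t.den : ℤ) ^ 4 + t.num ^ 2 * (t.den : ℤ) ^ 2 - t.num ^ 4 : ℤ) : ℚ) := by
    push_cast
    rw [← ht]
    linear_combination (t.den : ℚ) ^ 4 * hy
  have hint : IsSquare ((t.den : ℤ) ^ 4 + t.num ^ 2 * (t.den : ℤ) ^ 2 - t.num ^ 4) :=
    Rat.isSquare_intCast_iff.mp ⟨_, by rw [← hsq, sq]⟩
  obtain ⟨z, hz⟩ := hint
  have hcop : IsCoprime t.num (t.den : ℤ) := Rat.isCoprime_num_den t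
  rcases eq_zero_or_sq_eq_one_of_sq_eq (y := z) hcop (by rw [hz, sq]) with h0 | ⟨hn, hm⟩
  · exact Or.inl (Rat.num_eq_zero.mp h0)
  · right
    have hn' : (t.num : ℚ) ^ 2 = 1 := by exact_mod_cast hn
    have hm' : (t.den : ℚ) ^ 2 = 1 := by exact_mod_cast hm
    refine sq_eq_one_iff.mp ?_
    linear_combination hn' - t ^ 2 * hm' + (t * t.den + t.num) * ht
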